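/- Let D be an atomic length-factorial integral domain that is not a unique factorization domain, and let S be the multiplicative set consisting of all units of D together with all elements that can be written as a finite product of prime elements of D. Then the localization D_S is an atomic length-factorial domain with only finitely many irreducible elements up to associates (i.e., D_S is a Cohen–Kaplansky domain). -/

import Mathlib

/-- An atomic commutative ring (domain): every nonzero nonunit can be written as a finite
product of irreducible elements. -/
def IsAtomicRing (D : Type*) [CommRing D] : Prop :=
  ∀ x : D, x ≠ 0 → ¬IsUnit x → ∃ s : Multiset D, (∀ a ∈ s, Irreducible a) ∧ s.prod = x

/-- Length-factorial: whenever `x₁ ⋯ xₙ = y₁ ⋯ yₙ` with all `xᵢ` and `yⱼ` irreducible,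
there is a permutation matching each `xᵢ` with an associated `yⱼ`. -/
def IsLengthFactorialRing (D : Type*) [CommRing D] : Prop :=
  ∀ s t : Multiset D, (∀ a ∈ s, Irreducible a) → (∀ a ∈ t, Irreducible a) →
    s.prod = t.prod → Multiset.card s = Multiset.card t →
    Multiset.Rel Associated s t

/-- The multiplicative set consisting of all units of `D` together with all elements
that can be written as a finite product of prime elements of `D`. -/
def primeProducts (D : Type*) [CommRing D] [IsDomain D] : Submonoid D where
  carrier := {x | IsUnit x ∨ ∃ s : Multiset D, (∀ p ∈ s, Prime p) ∧ s.prod = x}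
  one_mem' := Or.inl isUnit_one
  mul_mem' := by
    have key : ∀ (u x : D), IsUnit u →
        (∃ s : Multiset D, (∀ p ∈ s, Prime p) ∧ s.prod = x) →
        IsUnit (u * x) ∨ ∃ s : Multiset D, (∀ p ∈ s, Prime p) ∧ s.prod = u * x := by
      rintro u x hu ⟨t, ht, rfl⟩
      rcases Multiset.empty_or_exists_mem t with rfl | ⟨p, hp⟩
      · exact Or.inl (by simpa using hu)
      · obtain ⟨t', rfl⟩ := Multiset.exists_cons_of_mem hp
        refine Or.inr ⟨(u * p) ::ₘ t', ?_, ?_⟩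
        · intro q hq
          rcases Multiset.mem_cons.mp hq with rfl | hq
          · obtain ⟨v, rfl⟩ := hu
            exact ((Associated.refl p).symm.trans ⟨v, mul_comm p v⟩).prime
              (ht p (Multiset.mem_cons_self p t'))
          · exact ht q (Multiset.mem_cons_of_mem hq)
        · rw [Multiset.prod_cons, Multiset.prod_cons, mul_assoc]
    rintro a b (ha | ha) (hb | hb)
    · exact Or.inl (ha.mul hb)
    · exact key a b ha hb
    · rw [mul_comm]; exact key b a hb ha
    · obtain ⟨s, hs, rfl⟩ := ha
      obtain ⟨t, ht, rfl⟩ := hb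
      exact Or.inr ⟨s + t, fun p hp => (Multiset.mem_add.mp hp).elim (hs p) (ht p),
        Multiset.prod_add s t⟩

section Factorizations

variable {R : Type*} [CommRing R]

theorem Multiset.Rel.prod_associated {s t : Multiset R} (h : Multiset.Rel Associated s t) :
    Associated s.prod t.prod := by
  rw [← Associates.mk_eq_mk_iff_associated, ← Associates.prod_mk, ← Associates.prod_mk,
    Associates.rel_associated_iff_map_eq_map.mp h]

/-- A unit can be absorbed into a nonempty product of irreducible elements. -/
theorem exists_rel_associated_prod_eq {s : Multiset R} {x : R} (hs : ∀ a ∈ s, Irreducible a)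
    (h0 : s ≠ 0) (hx : Associated s.prod x) :
    ∃ t : Multiset R, (∀ a ∈ t, Irreducible a) ∧ Multiset.Rel Associated s t ∧ t.prod = x := by
  obtain ⟨a, ha⟩ := Multiset.exists_mem_of_ne_zero h0
  obtain ⟨s, rfl⟩ := Multiset.exists_cons_of_mem ha
  obtain ⟨u, rfl⟩ := hx
  have hau : Associated a (a * u) := ⟨u, rfl⟩
  refine ⟨(a * u) ::ₘ s, ?_, ?_, ?_⟩
  · simp only [Multiset.mem_cons, forall_eq_or_imp] at hs ⊢
    exact ⟨hau.irreducible hs.1, hs.2⟩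
  · exact Multiset.Rel.cons hau (Multiset.rel_refl_of_refl_on fun x _ => Associated.refl x)
  · simp only [Multiset.prod_cons]
    ring

theorem isAtomicRing_of_exists_associated
    (h : ∀ x : R, x ≠ 0 → ∃ s : Multiset R, (∀ a ∈ s, Irreducible a) ∧ Associated s.prod x) :
    IsAtomicRing R := by
  intro x hx hu
  obtain ⟨s, hs, hsx⟩ := h x hx
  have h0 : s ≠ 0 := by
    rintro rfl
    exact hu (hsx.isUnit (by simp))
  obtain ⟨t, ht, -, htx⟩ := exists_rel_associated_prod_eq hs h0 hsx
  exact ⟨t, ht, htx⟩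

theorem IsAtomicRing.exists_associated (h : IsAtomicRing R) {x : R} (hx : x ≠ 0) :
    ∃ s : Multiset R, (∀ a ∈ s, Irreducible a) ∧ Associated s.prod x := by
  by_cases hu : IsUnit x
  · exact ⟨0, by simp, by simpa using (associated_one_iff_isUnit.mpr hu).symm⟩
  · obtain ⟨s, hs, rfl⟩ := h x hx hu
    exact ⟨s, hs, Associated.refl _⟩

theorem IsLengthFactorialRing.rel_of_associated (h : IsLengthFactorialRing R) {s t : Multiset R}
    (hs : ∀ a ∈ s, Irreducible a) (ht : ∀ a ∈ t, Irreducible a)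
    (hst : Associated s.prod t.prod) (hcard : s.card = t.card) :
    Multiset.Rel Associated s t := by
  rcases eq_or_ne s 0 with rfl | h0
  · obtain rfl : t = 0 := by simpa using hcard.symm
    exact Multiset.Rel.zero
  · obtain ⟨s', hs', hrel, hprod⟩ := exists_rel_associated_prod_eq hs h0 hst
    exact hrel.trans _ (h s' t hs' ht hprod ((Multiset.card_eq_card_of_rel hrel).symm.trans hcard))

/-- Given an unbalanced factorization relation `(s, t)`, any irreducible that occurs on only one
side of some relation already occurs in `s + t`. -/
theorem IsLengthFactorialRing.exists_mem_associated (h : IsLengthFactorialRing R)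
    {s t x y : Multiset R} (hs : ∀ a ∈ s, Irreducible a) (ht : ∀ a ∈ t, Irreducible a)
    (hx : ∀ a ∈ x, Irreducible a) (hy : ∀ a ∈ y, Irreducible a)
    (hst : Associated s.prod t.prod) (hxy : Associated x.prod y.prod)
    (hcard : t.card < s.card) {a : R} (ha : a ∈ x) (hay : ∀ b ∈ y, ¬Associated a b) :
    ∃ b ∈ s + t, Associated a b := by
  obtain ⟨n, hn⟩ := Nat.exists_eq_add_of_lt hcard
  have key : ∀ (m : ℕ) (v w : Multiset R), (∀ a ∈ v, Irreducible a) → (∀ a ∈ w, Irreducible a) →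
      Associated v.prod w.prod →
      (n + 1) * x.card + m * v.card = (n + 1) * y.card + m * w.card →
      ∃ b ∈ w, Associated a b := by
    intro m v w hv hw hvw hc
    have hrel : Multiset.Rel Associated ((n + 1) • x + m • v) ((n + 1) • y + m • w) := by
      refine h.rel_of_associated ?_ ?_ ?_ (by simpa using hc)
      · intro b hb
        rcases Multiset.mem_add.mp hb with hb | hb
        · exact hx b (Multiset.mem_of_mem_nsmul hb)
        · exact hv b (Multiset.mem_of_mem_nsmul hb)
      · intro b hb
        rcases Multiset.mem_add.mp hb with hb | hb
        · exact hy b (Multiset.mem_of_mem_nsmul hb)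
        · exact hw b (Multiset.mem_of_mem_nsmul hb)
      · simp only [Multiset.prod_add, Multiset.prod_nsmul]
        exact hxy.pow_pow.mul_mul hvw.pow_pow
    obtain ⟨b, hb, hab⟩ := Multiset.exists_mem_of_rel_of_mem hrel
      (Multiset.mem_add.mpr (Or.inl (Multiset.mem_nsmul.mpr ⟨n.succ_ne_zero, ha⟩)))
    rcases Multiset.mem_add.mp hb with hb | hb
    · exact absurd hab (hay b (Multiset.mem_of_mem_nsmul hb))
    · exact ⟨b, Multiset.mem_of_mem_nsmul hb, hab⟩
  rcases le_total y.card x.card with hle | hle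
  · obtain ⟨m, hm⟩ := Nat.exists_eq_add_of_le hle
    obtain ⟨b, hb, hab⟩ := key m t s ht hs hst.symm (by rw [hn, hm]; ring)
    exact ⟨b, Multiset.mem_add.mpr (Or.inl hb), hab⟩
  · obtain ⟨m, hm⟩ := Nat.exists_eq_add_of_le hle
    obtain ⟨b, hb, hab⟩ := key m s t hs ht hst (by rw [hn, hm]; ring)
    exact ⟨b, Multiset.mem_add.mpr (Or.inr hb), hab⟩

variable [IsDomain R]

theorem IsAtomicRing.exists_relation_of_not_prime (hat : IsAtomicRing R) {a : R}
    (ha : Irreducible a) (hp : ¬Prime a) :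
    ∃ x y : Multiset R, (∀ b ∈ x, Irreducible b) ∧ (∀ b ∈ y, Irreducible b) ∧
      Associated x.prod y.prod ∧ a ∈ x ∧ ∀ b ∈ y, ¬Associated a b := by
  obtain ⟨b, c, ⟨d, hd⟩, hb, hc⟩ : ∃ b c, a ∣ b * c ∧ ¬a ∣ b ∧ ¬a ∣ c := by
    by_contra! hcon
    exact hp ⟨ha.ne_zero, ha.not_isUnit, fun b c h => or_iff_not_imp_left.mpr (hcon b c h)⟩
  have hb0 : b ≠ 0 := fun h => hb (h ▸ dvd_zero a)
  have hc0 : c ≠ 0 := fun h => hc (h ▸ dvd_zero a)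
  have hd0 : d ≠ 0 := by
    rintro rfl
    rw [mul_zero] at hd
    exact mul_ne_zero hb0 hc0 hd
  obtain ⟨s, hs, hsb⟩ := hat.exists_associated hb0
  obtain ⟨t, ht, htc⟩ := hat.exists_associated hc0
  obtain ⟨r, hr, hrd⟩ := hat.exists_associated hd0
  refine ⟨a ::ₘ r, s + t, ?_, ?_, ?_, Multiset.mem_cons_self a r, ?_⟩
  · simpa using ⟨ha, hr⟩
  · intro e he
    exact (Multiset.mem_add.mp he).elim (hs e) (ht e)
  · rw [Multiset.prod_cons, Multiset.prod_add]
    refine ((Associated.refl a).mul_mul hrd).trans ?_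
    rw [← hd]
    exact (hsb.mul_mul htc).symm
  · intro e he hae
    rcases Multiset.mem_add.mp he with he | he
    · exact hb (hae.dvd.trans ((Multiset.dvd_prod he).trans hsb.dvd))
    · exact hc (hae.dvd.trans ((Multiset.dvd_prod he).trans htc.dvd))

/-- An atomic length-factorial domain has only finitely many nonprime irreducible elements up to
associates. -/
theorem IsLengthFactorialRing.exists_multiset_not_prime (h : IsLengthFactorialRing R)
    (hat : IsAtomicRing R) :
    ∃ F : Multiset R, ∀ a, Irreducible a → ¬Prime a → ∃ b ∈ F, Associated a b := by
  by_cases hex : ∃ a₀ : R, Irreducible a₀ ∧ ¬Prime a₀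
  · obtain ⟨a₀, ha₀, hp₀⟩ := hex
    obtain ⟨s, t, hs, ht, hst, has, hat₀⟩ := hat.exists_relation_of_not_prime ha₀ hp₀
    refine ⟨s + t, fun a ha hp => ?_⟩
    obtain ⟨x, y, hx, hy, hxy, hax, hay⟩ := hat.exists_relation_of_not_prime ha hp
    rcases lt_trichotomy t.card s.card with hlt | heq | hlt
    · exact h.exists_mem_associated hs ht hx hy hst hxy hlt hax hay
    · obtain ⟨b, hb, hab⟩ := Multiset.exists_mem_of_rel_of_mem
        (h.rel_of_associated hs ht hst heq.symm) has
      exact absurd hab (hat₀ b hb)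
    · rw [add_comm]
      exact h.exists_mem_associated ht hs hx hy hst.symm hxy hlt hax hay
  · push Not at hex
    exact ⟨0, fun a ha hp => absurd (hex a ha) hp⟩

end Factorizations

section PrimeProducts

variable {D : Type*} [CommRing D] [IsDomain D]

theorem Prime.mem_primeProducts {p : D} (hp : Prime p) : p ∈ primeProducts D :=
  Or.inr ⟨{p}, by simpa using hp, by simp⟩

theorem primeProducts_le_nonZeroDivisors : primeProducts D ≤ nonZeroDivisors D := by
  rintro x (hx | ⟨s, hs, rfl⟩)
  · exact hx.mem_nonZeroDivisors
  · refine mem_nonZeroDivisors_of_ne_zero (Multiset.prod_ne_zero fun h0 => ?_)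
    exact (hs 0 h0).ne_zero rfl

theorem exists_mul_eq_of_mem_primeProducts {σ : D} (hσ : σ ∈ primeProducts D) {a x y : D}
    (h : σ * a = x * y) :
    ∃ σ₁ ∈ primeProducts D, ∃ σ₂ ∈ primeProducts D, ∃ x' y',
      x = σ₁ * x' ∧ y = σ₂ * y' ∧ a = x' * y' := by
  rcases hσ with ⟨u, rfl⟩ | ⟨s, hs, rfl⟩
  · refine ⟨u, Or.inl u.isUnit, 1, one_mem _, ↑u⁻¹ * x, y, by simp, by simp, ?_⟩
    rw [mul_assoc, ← h, Units.inv_mul_cancel_left]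
  · induction s using Multiset.induction generalizing x y with
    | empty => exact ⟨1, one_mem _, 1, one_mem _, x, y, by simp, by simp, by simpa using h⟩
    | cons p s ih =>
      simp only [Multiset.mem_cons, forall_eq_or_imp] at hs
      obtain ⟨hp, hs⟩ := hs
      rw [Multiset.prod_cons, mul_assoc] at h
      rcases hp.dvd_or_dvd (Dvd.intro _ h) with ⟨z, rfl⟩ | ⟨z, rfl⟩
      · have h' : s.prod * a = z * y := mul_left_cancel₀ hp.ne_zero (by rw [h]; ring)
        obtain ⟨σ₁, h₁, σ₂, h₂, x', y', rfl, rfl, e⟩ := ih hs h'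
        exact ⟨p * σ₁, mul_mem hp.mem_primeProducts h₁, σ₂, h₂, x', y', by ring, rfl, e⟩
      · have h' : s.prod * a = x * z := mul_left_cancel₀ hp.ne_zero (by rw [h]; ring)
        obtain ⟨σ₁, h₁, σ₂, h₂, x', y', rfl, rfl, e⟩ := ih hs h'
        exact ⟨σ₁, h₁, p * σ₂, mul_mem hp.mem_primeProducts h₂, x', y', rfl, by ring, e⟩

theorem isUnit_of_mem_primeProducts_of_dvd {σ a : D} (hσ : σ ∈ primeProducts D)
    (ha : ∀ p, Prime p → ¬p ∣ a) (h : σ ∣ a) : IsUnit σ := by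
  rcases hσ with hσ | ⟨s, hs, rfl⟩
  · exact hσ
  · rcases Multiset.empty_or_exists_mem s with rfl | ⟨p, hp⟩
    · simp
    · exact absurd ((Multiset.dvd_prod hp).trans h) (ha p (hs p hp))

theorem mem_primeProducts_of_dvd {σ a : D} (hσ : σ ∈ primeProducts D) (h : a ∣ σ) :
    a ∈ primeProducts D := by
  obtain ⟨d, rfl⟩ := h
  obtain ⟨σ₁, h₁, -, -, x', y', rfl, -, e⟩ :=
    exists_mul_eq_of_mem_primeProducts (a := 1) hσ (mul_one _)
  exact mul_mem h₁ (Or.inl (IsUnit.of_mul_eq_one y' e.symm))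

theorem dvd_of_mul_eq_mul_of_mem_primeProducts {σ τ a b : D} (hσ : σ ∈ primeProducts D)
    (hb : ∀ p, Prime p → ¬p ∣ b) (h : σ * a = τ * b) : b ∣ a := by
  obtain ⟨-, -, σ₂, h₂, x', y', -, rfl, rfl⟩ := exists_mul_eq_of_mem_primeProducts hσ h
  have hu := isUnit_of_mem_primeProducts_of_dvd h₂ hb (dvd_mul_right _ _)
  exact (hu.mul_left_dvd).mpr (dvd_mul_left _ _)

theorem Irreducible.not_prime_dvd {a : D} (ha : Irreducible a) (hp : ¬Prime a) :
    ∀ p, Prime p → ¬p ∣ a := fun _ hq hdvd =>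
  hp ((hq.irreducible.associated_of_dvd ha hdvd).prime hq)

theorem not_prime_dvd_multiset_prod {s : Multiset D} (hs : ∀ a ∈ s, Irreducible a ∧ ¬Prime a) :
    ∀ p, Prime p → ¬p ∣ s.prod := fun p hp hdvd => by
  obtain ⟨a, ha, hpa⟩ := hp.exists_mem_multiset_dvd hdvd
  exact (hs a ha).1.not_prime_dvd (hs a ha).2 p hp hpa

variable {L : Type*} [CommRing L] [Algebra D L] [IsLocalization (primeProducts D) L]

variable (L) in
theorem isUnit_algebraMap_of_mem_primeProducts {a : D} (ha : a ∈ primeProducts D) :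
    IsUnit (algebraMap D L a) :=
  IsLocalization.map_units L (⟨a, ha⟩ : primeProducts D)

theorem algebraMap_injective_primeProducts : Function.Injective (algebraMap D L) :=
  IsLocalization.injective L primeProducts_le_nonZeroDivisors

theorem exists_associated_algebraMap (z : L) : ∃ x : D, Associated z (algebraMap D L x) := by
  obtain ⟨⟨x, σ⟩, h⟩ := IsLocalization.surj (primeProducts D) z
  exact ⟨x, (IsLocalization.map_units L σ).unit, h⟩

theorem mem_primeProducts_of_isUnit_algebraMap {a : D} (h : IsUnit (algebraMap D L a)) :
    a ∈ primeProducts D := by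
  obtain ⟨w, hw⟩ := h.exists_right_inv
  obtain ⟨⟨x, σ⟩, hx⟩ := IsLocalization.surj (primeProducts D) w
  refine mem_primeProducts_of_dvd σ.2 ⟨x, algebraMap_injective_primeProducts (L := L) ?_⟩
  rw [map_mul, ← hx, ← mul_assoc, hw, one_mul]

theorem irreducible_algebraMap_of_not_prime {a : D} (ha : Irreducible a) (hp : ¬Prime a) :
    Irreducible (algebraMap D L a) := by
  refine ⟨fun hu => ha.not_isUnit (isUnit_of_mem_primeProducts_of_dvd
    (mem_primeProducts_of_isUnit_algebraMap hu) (ha.not_prime_dvd hp) dvd_rfl), ?_⟩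
  intro z w hzw
  obtain ⟨⟨x, σ⟩, hx⟩ := IsLocalization.surj (primeProducts D) z
  obtain ⟨⟨y, τ⟩, hy⟩ := IsLocalization.surj (primeProducts D) w
  have h : (σ * τ : D) * a = x * y := by
    apply algebraMap_injective_primeProducts (L := L)
    simp only [map_mul] at hx hy ⊢
    rw [hzw, ← hx, ← hy]
    ring
  obtain ⟨σ₁, h₁, σ₂, h₂, x', y', hx', hy', rfl⟩ :=
    exists_mul_eq_of_mem_primeProducts (mul_mem σ.2 τ.2) h
  rcases ha.isUnit_or_isUnit rfl with hu | hu
  · refine Or.inl (isUnit_of_mul_isUnit_left (y := algebraMap D L σ) ?_)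
    rw [hx]
    exact isUnit_algebraMap_of_mem_primeProducts L (hx' ▸ mul_mem h₁ (Or.inl hu))
  · refine Or.inr (isUnit_of_mul_isUnit_left (y := algebraMap D L τ) ?_)
    rw [hy]
    exact isUnit_algebraMap_of_mem_primeProducts L (hy' ▸ mul_mem h₂ (Or.inl hu))

variable (L) in
theorem exists_not_prime_associated_algebraMap_prod {s : Multiset D}
    (hs : ∀ a ∈ s, Irreducible a) :
    ∃ t : Multiset D, (∀ a ∈ t, Irreducible a ∧ ¬Prime a) ∧
      Associated (t.map (algebraMap D L)).prod (algebraMap D L s.prod) := by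
  induction s using Multiset.induction with
  | empty => exact ⟨0, by simp, by simp⟩
  | cons p s ih =>
    simp only [Multiset.mem_cons, forall_eq_or_imp] at hs
    obtain ⟨t, ht, hts⟩ := ih hs.2
    rw [Multiset.prod_cons, map_mul]
    by_cases hp : Prime p
    · exact ⟨t, ht, (associated_isUnit_mul_right_iff
        (isUnit_algebraMap_of_mem_primeProducts L hp.mem_primeProducts)).mpr hts⟩
    · refine ⟨p ::ₘ t, ?_, ?_⟩
      · simpa using ⟨⟨hs.1, hp⟩, ht⟩
      · rw [Multiset.map_cons, Multiset.prod_cons]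
        exact (Associated.refl _).mul_mul hts

theorem IsAtomicRing.exists_not_prime_associated (hat : IsAtomicRing D) {z : L} (hz : z ≠ 0) :
    ∃ t : Multiset D, (∀ a ∈ t, Irreducible a ∧ ¬Prime a) ∧
      Associated (t.map (algebraMap D L)).prod z := by
  obtain ⟨x, hx⟩ := exists_associated_algebraMap (D := D) z
  have hx0 : x ≠ 0 := by
    rintro rfl
    rw [map_zero] at hx
    exact hz ((associated_zero_iff_eq_zero z).mp hx)
  obtain ⟨s, hs, hsx⟩ := hat.exists_associated hx0
  obtain ⟨t, ht, hts⟩ := exists_not_prime_associated_algebraMap_prod L hs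
  exact ⟨t, ht, hts.trans ((hsx.map (algebraMap D L)).trans hx.symm)⟩

theorem IsAtomicRing.localization_primeProducts (hat : IsAtomicRing D) : IsAtomicRing L := by
  refine isAtomicRing_of_exists_associated fun z hz => ?_
  obtain ⟨t, ht, htz⟩ := hat.exists_not_prime_associated hz
  refine ⟨t.map (algebraMap D L), ?_, htz⟩
  simp only [Multiset.mem_map, forall_exists_index, and_imp, forall_apply_eq_imp_iff₂]
  exact fun a ha => irreducible_algebraMap_of_not_prime (ht a ha).1 (ht a ha).2

theorem IsAtomicRing.exists_associated_of_irreducible (hat : IsAtomicRing D) {z : L}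
    (hz : Irreducible z) :
    ∃ a : D, (Irreducible a ∧ ¬Prime a) ∧ Associated z (algebraMap D L a) := by
  have : IsDomain L := IsLocalization.isDomain_of_le_nonZeroDivisors (R := D) L
    primeProducts_le_nonZeroDivisors
  obtain ⟨t, ht, htz⟩ := hat.exists_not_prime_associated hz.ne_zero
  rcases Multiset.empty_or_exists_mem t with rfl | ⟨a, ha⟩
  · exact absurd (htz.isUnit (by simp)) hz.not_isUnit
  · have hirr : Irreducible (algebraMap D L a) :=
      irreducible_algebraMap_of_not_prime (ht a ha).1 (ht a ha).2
    refine ⟨a, ht a ha, (hirr.associated_of_dvd hz ?_).symm⟩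
    exact (Multiset.dvd_prod (Multiset.mem_map_of_mem _ ha)).trans htz.dvd

theorem IsAtomicRing.exists_rel_associated_of_irreducible (hat : IsAtomicRing D) {s : Multiset L}
    (hs : ∀ z ∈ s, Irreducible z) :
    ∃ t : Multiset D, (∀ a ∈ t, Irreducible a ∧ ¬Prime a) ∧
      Multiset.Rel Associated s (t.map (algebraMap D L)) := by
  induction s using Multiset.induction with
  | empty => exact ⟨0, by simp, by simp⟩
  | cons z s ih =>
    simp only [Multiset.mem_cons, forall_eq_or_imp] at hs
    obtain ⟨t, ht, hst⟩ := ih hs.2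
    obtain ⟨a, ha, hza⟩ := hat.exists_associated_of_irreducible hs.1
    refine ⟨a ::ₘ t, by simpa using ⟨ha, ht⟩, ?_⟩
    rw [Multiset.map_cons]
    exact hst.cons hza

theorem associated_of_associated_algebraMap {a b : D} (ha : ∀ p, Prime p → ¬p ∣ a)
    (hb : ∀ p, Prime p → ¬p ∣ b) (h : Associated (algebraMap D L a) (algebraMap D L b)) :
    Associated a b := by
  obtain ⟨u, hu⟩ := h
  obtain ⟨⟨x, τ⟩, hx⟩ := IsLocalization.surj (primeProducts D) (u : L)
  have hxS : x ∈ primeProducts D := by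
    apply mem_primeProducts_of_isUnit_algebraMap (L := L)
    rw [← hx]
    exact u.isUnit.mul (IsLocalization.map_units L τ)
  have key : x * a = τ * b := by
    apply algebraMap_injective_primeProducts (L := L)
    simp only [map_mul] at hx ⊢
    rw [← hx, ← hu]
    ring
  exact associated_of_dvd_dvd (dvd_of_mul_eq_mul_of_mem_primeProducts τ.2 ha key.symm)
    (dvd_of_mul_eq_mul_of_mem_primeProducts hxS hb key)

theorem IsLengthFactorialRing.localization_primeProducts (hlf : IsLengthFactorialRing D)
    (hat : IsAtomicRing D) : IsLengthFactorialRing L := by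
  intro s t hs ht hst hcard
  obtain ⟨s', hs', hss⟩ := hat.exists_rel_associated_of_irreducible hs
  obtain ⟨t', ht', htt⟩ := hat.exists_rel_associated_of_irreducible ht
  have hprod : Associated (algebraMap D L s'.prod) (algebraMap D L t'.prod) := by
    rw [map_multiset_prod, map_multiset_prod]
    exact hss.prod_associated.symm.trans (hst ▸ htt.prod_associated)
  have hcard' : s'.card = t'.card := by
    have h₁ := Multiset.card_eq_card_of_rel hss
    have h₂ := Multiset.card_eq_card_of_rel htt
    rw [Multiset.card_map] at h₁ h₂
    omega
  have hrel := hlf.rel_of_associated (fun a ha => (hs' a ha).1) (fun a ha => (ht' a ha).1)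
    (associated_of_associated_algebraMap (not_prime_dvd_multiset_prod hs')
      (not_prime_dvd_multiset_prod ht') hprod) hcard'
  have hmap : Multiset.Rel Associated (s'.map (algebraMap D L)) (t'.map (algebraMap D L)) :=
    Multiset.rel_map.mpr (hrel.mono fun a _ b _ hab => hab.map (algebraMap D L))
  rw [Associates.rel_associated_iff_map_eq_map] at hss htt hmap ⊢
  rw [hss, hmap, htt]

end PrimeProducts

/-- If `D` is an atomic length-factorial domain that is not a UFD and `S` is the set of
units together with products of primes, then the localization `D_S` is an atomic
length-factorial domain with only finitely many irreducibles up to associates, i.e.,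
a Cohen–Kaplansky domain. -/
theorem localization_at_primeProducts_is_CK (D : Type*) [CommRing D] [IsDomain D]
    (hat : IsAtomicRing D) (hlf : IsLengthFactorialRing D)
    (hnot : ¬UniqueFactorizationMonoid D) :
    IsDomain (Localization (primeProducts D)) ∧
      IsAtomicRing (Localization (primeProducts D)) ∧
      IsLengthFactorialRing (Localization (primeProducts D)) ∧
      ∃ F : Finset (Localization (primeProducts D)),
        ∀ a : Localization (primeProducts D), Irreducible a → ∃ b ∈ F, Associated a b := by
  have hfin : ∃ F : Finset (Localization (primeProducts D)),
      ∀ a : Localization (primeProducts D), Irreducible a → ∃ b ∈ F, Associated a b := by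
    classical
    obtain ⟨F, hF⟩ := hlf.exists_multiset_not_prime hat
    refine ⟨(F.map (algebraMap D (Localization (primeProducts D)))).toFinset, fun z hz => ?_⟩
    obtain ⟨a, ⟨ha, hp⟩, hza⟩ := hat.exists_associated_of_irreducible hz
    obtain ⟨b, hb, hab⟩ := hF a ha hp
    exact ⟨algebraMap D _ b, Multiset.mem_toFinset.mpr (Multiset.mem_map_of_mem _ hb),
      hza.trans (hab.map (algebraMap D _))⟩
  exact ⟨IsLocalization.isDomain_localization primeProducts_le_nonZeroDivisors,
    hat.localization_primeProducts, hlf.localization_primeProducts hat, hfin⟩
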